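/- Let F_1, …, F_U : E → ℝ (U ≥ 1) each be differentiable, convex, and L-smooth (L > 0), define the global objective F(w) = (1/U)∑_{u=1}^U F_u(w), and let θ* ∈ E be any point. Fix θ ∈ E, τ ≥ 1, and arbitrary points x_{u,k} ∈ E for u = 1, …, U and k = 0, …, τ−1. Then (1/U)·∑_{u=1}^U ∑_{k=0}^{τ−1} ⟨θ − θ*, ∇F_u(x_{u,k})⟩ ≥ τ·(F(θ) − F(θ*)) − (L/(2U))·∑_{u=1}^U ∑_{k=0}^{τ−1} ‖θ − x_{u,k}‖². -/

import Mathlib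

open RealInnerProductSpace

/-- A differentiable function has the expected derivative along a segment. -/
theorem Differentiable.hasDerivAt_comp_lineMap {E : Type*} [NormedAddCommGroup E]
    [InnerProductSpace ℝ E] [CompleteSpace E] {f : E → ℝ} (hf : Differentiable ℝ f)
    (x y : E) (t : ℝ) :
    HasDerivAt (fun s : ℝ => f (AffineMap.lineMap x y s))
      ⟪gradient f (AffineMap.lineMap x y t), y - x⟫ t := by
  have h := (hf (AffineMap.lineMap x y t)).hasGradientAt.hasFDerivAt.comp_hasDerivAt t
    (AffineMap.hasDerivAt_lineMap (a := x) (b := y) (x := t))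
  simpa [Function.comp_def] using h

/-- First-order lower bound for a convex differentiable function. -/
theorem ConvexOn.add_inner_gradient_le {E : Type*} [NormedAddCommGroup E]
    [InnerProductSpace ℝ E] [CompleteSpace E] {f : E → ℝ} (hc : ConvexOn ℝ Set.univ f)
    (hf : Differentiable ℝ f) (x y : E) :
    f x + ⟪gradient f x, y - x⟫ ≤ f y := by
  have hg := hc.comp_affineMap (AffineMap.lineMap x y : ℝ →ᵃ[ℝ] E)
  have hd := hf.hasDerivAt_comp_lineMap x y 0
  have h := hg.le_slope_of_hasDerivAt (Set.mem_univ (0 : ℝ)) (Set.mem_univ (1 : ℝ)) one_pos hd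
  simp only [slope_def_field, Function.comp_apply, AffineMap.lineMap_apply_zero,
    AffineMap.lineMap_apply_one, sub_zero, div_one] at h
  linarith

/-- Quadratic upper bound (descent lemma) for a function with Lipschitz gradient. -/
theorem Differentiable.le_add_inner_gradient_add_sq {E : Type*} [NormedAddCommGroup E]
    [InnerProductSpace ℝ E] [CompleteSpace E] {f : E → ℝ} {L : ℝ} (hf : Differentiable ℝ f)
    (hs : ∀ x y : E, ‖gradient f x - gradient f y‖ ≤ L * ‖x - y‖) (x y : E) :
    f y ≤ f x + ⟪gradient f x, y - x⟫ + L / 2 * ‖y - x‖ ^ 2 := by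
  have hd (t : ℝ) : HasDerivAt
      (fun s : ℝ => s * ⟪gradient f x, y - x⟫ + L / 2 * ‖y - x‖ ^ 2 * s ^ 2
        - f (AffineMap.lineMap x y s))
      (⟪gradient f x, y - x⟫ + L * ‖y - x‖ ^ 2 * t
        - ⟪gradient f (AffineMap.lineMap x y t), y - x⟫) t := by
    refine HasDerivAt.sub ?_ (hf.hasDerivAt_comp_lineMap x y t)
    refine (((hasDerivAt_id t).mul_const ⟪gradient f x, y - x⟫).add
      ((hasDerivAt_pow 2 t).const_mul (L / 2 * ‖y - x‖ ^ 2))).congr_deriv ?_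
    push_cast
    ring
  have hmono := monotoneOn_of_hasDerivWithinAt_nonneg (convex_Icc (0 : ℝ) 1)
    (fun t _ => (hd t).continuousAt.continuousWithinAt)
    (fun t _ => (hd t).hasDerivWithinAt) (fun t ht => by
      rw [interior_Icc] at ht
      have h := real_inner_le_norm (gradient f (AffineMap.lineMap x y t) - gradient f x) (y - x)
      have hL := hs (AffineMap.lineMap x y t) x
      have hn : ‖(AffineMap.lineMap x y t : E) - x‖ = t * ‖y - x‖ := by
        simp [AffineMap.lineMap_apply, norm_smul, abs_of_pos ht.1]
      rw [hn] at hL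
      rw [inner_sub_left] at h
      nlinarith [mul_le_mul_of_nonneg_right hL (norm_nonneg (y - x))])
  have h := hmono (Set.left_mem_Icc.2 zero_le_one) (Set.right_mem_Icc.2 zero_le_one) zero_le_one
  simp only [AffineMap.lineMap_apply_zero, AffineMap.lineMap_apply_one] at h
  linarith

/-- Three-point inequality for convex functions with Lipschitz gradient. -/
theorem ConvexOn.sub_sub_sq_le_inner_gradient {E : Type*} [NormedAddCommGroup E]
    [InnerProductSpace ℝ E] [CompleteSpace E] {f : E → ℝ} {L : ℝ}
    (hc : ConvexOn ℝ Set.univ f) (hf : Differentiable ℝ f)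
    (hs : ∀ x y : E, ‖gradient f x - gradient f y‖ ≤ L * ‖x - y‖) (a b z : E) :
    f a - f b - L / 2 * ‖a - z‖ ^ 2 ≤ ⟪a - b, gradient f z⟫ := by
  have h₁ := hc.add_inner_gradient_le hf z b
  have h₂ := hf.le_add_inner_gradient_add_sq hs z a
  have h₃ : ⟪a - b, gradient f z⟫ = ⟪gradient f z, a - z⟫ - ⟪gradient f z, b - z⟫ := by
    rw [← inner_sub_right, sub_sub_sub_cancel_right, real_inner_comm]
  linarith

/-- Bound A1: the averaged aggregate inner product is bounded below in terms of the global
objective gap and the client drift. -/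
theorem aggregate_inner_lower_bound {E : Type*} [NormedAddCommGroup E]
    [InnerProductSpace ℝ E] [CompleteSpace E]
    (U : ℕ) (hU : 1 ≤ U) (F : Fin U → E → ℝ) (L : ℝ) (hL : 0 < L)
    (hdiff : ∀ u, Differentiable ℝ (F u))
    (hconv : ∀ u, ConvexOn ℝ Set.univ (F u))
    (hsmooth : ∀ u, ∀ x y : E, ‖gradient (F u) x - gradient (F u) y‖ ≤ L * ‖x - y‖)
    (Fglob : E → ℝ) (hFglob : ∀ w : E, Fglob w = (1 / (U : ℝ)) * ∑ u : Fin U, F u w)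
    (θstar θ : E) (τ : ℕ) (hτ : 1 ≤ τ)
    (x : Fin U → ℕ → E) :
    (1 / (U : ℝ)) * ∑ u : Fin U, ∑ k ∈ Finset.range τ, ⟪θ - θstar, gradient (F u) (x u k)⟫ ≥
      (τ : ℝ) * (Fglob θ - Fglob θstar) -
        (L / (2 * (U : ℝ))) * ∑ u : Fin U, ∑ k ∈ Finset.range τ, ‖θ - x u k‖ ^ 2 := by
  have h := Finset.sum_le_sum fun u (_ : u ∈ Finset.univ) =>
    Finset.sum_le_sum fun k (_ : k ∈ Finset.range τ) =>
      (hconv u).sub_sub_sq_le_inner_gradient (hdiff u) (hsmooth u) θ θstar (x u k)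
  simp only [Finset.sum_sub_distrib, Finset.sum_const, Finset.card_range, nsmul_eq_mul,
    ← Finset.mul_sum] at h
  rw [hFglob, hFglob, ge_iff_le]
  refine le_trans (le_of_eq ?_) (mul_le_mul_of_nonneg_left h (by positivity))
  field_simp
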